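/- Let S and T be properly sharing term graphs, let u be a node of S that is not a node of T, and let C = term(S[u ← □]), where □ is a fresh constant and □ also denotes the one-node graph labelled □. Then term(S[u ← T]) = C[term(T), …, term(T)], i.e. the term obtained from the context C by filling every occurrence of the hole with term(T). -/

import Mathlib

namespace TermGraphs

/-- First-order terms over a signature `F` and variables `V`. -/
inductive Tm (F V : Type) : Type
  | var : V → Tm F V
  | app : F → List (Tm F V) → Tm F V

/-- A (pre-)graph over labels `L`: a finite set of nodes (drawn from `ℕ`),
a successor map assigning each node an ordered sequence of nodes,
a labelling, and a designated root node. -/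
structure PreGraph (L : Type) where
  nodes : Finset ℕ
  suc : ℕ → List ℕ
  lab : ℕ → L
  root : ℕ

variable {F V L : Type}

/-- The edge relation of a graph: `u → v` iff `v` occurs in `suc u`. -/
def Edge (G : PreGraph L) (u v : ℕ) : Prop := u ∈ G.nodes ∧ v ∈ G.suc u

/-- `v` is reachable from `u` in `G`. -/
def Reach (G : PreGraph L) : ℕ → ℕ → Prop := Relation.ReflTransGen (Edge G)

/-- `ReachesP G u p v`: starting in `u` and following the position `p`
(a sequence of argument indices) one reaches the node `v`. -/
inductive ReachesP (G : PreGraph L) : ℕ → List ℕ → ℕ → Prop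
  | nil (u : ℕ) : ReachesP G u [] u
  | cons {u v w : ℕ} {i : ℕ} {p : List ℕ} :
      u ∈ G.nodes → (G.suc u)[i]? = some v → ReachesP G v p w →
      ReachesP G u (i :: p) w

/-- `p` is a position of the node `u` in `G`, i.e. `p ∈ Pos_G(u)`. -/
def IsPos (G : PreGraph L) (u : ℕ) (p : List ℕ) : Prop := ReachesP G G.root p u

/-- A node is unshared if its set of positions is a singleton. -/
def Unshared (G : PreGraph L) (u : ℕ) : Prop := ∃! p, IsPos G u p

/-- A node `u` is strictly below the position `p` if `p` is a proper prefix of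
some position of `u`. -/
def StrictlyBelow (G : PreGraph L) (p : List ℕ) (u : ℕ) : Prop :=
  ∃ q, IsPos G u q ∧ p <+: q ∧ p ≠ q

open Classical in
/-- `S↾u`, the subgraph of `S` reachable from the node `u`. -/
noncomputable def subgraph (G : PreGraph L) (u : ℕ) : PreGraph L where
  nodes := G.nodes.filter fun v => Reach G u v
  suc := G.suc
  lab := G.lab
  root := u

/-- The union `G ∪ H` of two graphs (for properly sharing graphs this
is symmetric on the common nodes). -/
def gUnion (G H : PreGraph L) : PreGraph L where
  nodes := G.nodes ∪ H.nodes
  suc := fun u => if u ∈ G.nodes then G.suc u else H.suc u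
  lab := fun u => if u ∈ G.nodes then G.lab u else H.lab u
  root := G.root

/-- Two graphs are properly sharing if every common node carries the same
label and the same successor sequence in both. -/
def ProperlySharing (G H : PreGraph L) : Prop :=
  ∀ u, u ∈ G.nodes → u ∈ H.nodes → G.lab u = H.lab u ∧ G.suc u = H.suc u

/-- The redirection `G[u ≫ v]`: the node `u` is removed (and `v` added), and
`u` is replaced by `v` in all successor sequences. -/
def redirect (G : PreGraph L) (u v : ℕ) : PreGraph L where
  nodes := insert v (G.nodes.erase u)
  suc := fun w => (G.suc w).map fun x => if x = u then v else x
  lab := G.lab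
  root := if G.root = u then v else G.root

/-- The replacement `G[u ← H]`: the subgraph of `G[u ≫ root(H)] ∪ H` reachable
from `root(H)` if `u = root(G)`, and from `root(G)` otherwise. -/
noncomputable def replaceAt (G : PreGraph L) (u : ℕ) (H : PreGraph L) : PreGraph L :=
  subgraph (gUnion H (redirect G u H.root)) (if u = G.root then H.root else G.root)

/-- A term graph over the signature `F` (with arities `ar`) and variables `V`:
an acyclic rooted graph whose nodes are labelled by function symbols or
variables, such that a node labelled by `f` has `ar f` successors, a node
labelled by a variable has no successors, and variable nodes are shared. -/
structure IsTermGraph (ar : F → ℕ) (G : PreGraph (F ⊕ V)) : Prop where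
  closed : ∀ u ∈ G.nodes, ∀ v ∈ G.suc u, v ∈ G.nodes
  acyclic : ∀ u v : ℕ, Relation.TransGen (Edge G) u v → u ≠ v
  rootMem : G.root ∈ G.nodes
  rootReach : ∀ u ∈ G.nodes, Reach G G.root u
  funArity : ∀ u ∈ G.nodes, ∀ f : F, G.lab u = Sum.inl f → (G.suc u).length = ar f
  varSuc : ∀ u ∈ G.nodes, ∀ x : V, G.lab u = Sum.inr x → G.suc u = []
  varShared : ∀ u ∈ G.nodes, ∀ v ∈ G.nodes, ∀ x : V,
      G.lab u = Sum.inr x → G.lab v = Sum.inr x → u = v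

/-- Fuelled computation of the term represented by (the subgraph at) a node.
For a term graph, any fuel strictly exceeding the length of the longest
path suffices; acyclicity bounds path lengths by the number of nodes. -/
noncomputable def termAt [Inhabited V] (G : PreGraph (F ⊕ V)) : ℕ → ℕ → Tm F V
  | 0, _ => Tm.var default
  | fuel + 1, u =>
    match G.lab u with
    | Sum.inr x => Tm.var x
    | Sum.inl f => Tm.app f ((G.suc u).map fun v => termAt G fuel v)

/-- `term(G)`, the term represented by the term graph `G`. -/
noncomputable def termOf [Inhabited V] (G : PreGraph (F ⊕ V)) : Tm F V :=
  termAt G (G.nodes.card + 1) G.root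

/-- Application of a substitution `σ : V → Tm F V` to a term. -/
def substTm (σ : V → Tm F V) : Tm F V → Tm F V
  | Tm.var x => σ x
  | Tm.app f ts => Tm.app f (ts.attach.map fun t => substTm σ t.1)
decreasing_by
  have := List.sizeOf_lt_of_mem t.2
  simp only [Tm.app.sizeOf_spec]
  omega

/-- The variable `x` occurs in the term `t`. -/
inductive OccursIn (x : V) : Tm F V → Prop
  | var : OccursIn x (Tm.var x)
  | app {f : F} {ts : List (Tm F V)} {t : Tm F V} :
      t ∈ ts → OccursIn x t → OccursIn x (Tm.app f ts)

/-- A morphism `m : L → S` of term graphs: it maps nodes to nodes, root to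
root, and preserves labels and successor sequences at every node of `L`
labelled by a function symbol. -/
structure IsMorphism (L S : PreGraph (F ⊕ V)) (m : ℕ → ℕ) : Prop where
  maps : ∀ u ∈ L.nodes, m u ∈ S.nodes
  root : m L.root = S.root
  lab : ∀ u ∈ L.nodes, ∀ f : F, L.lab u = Sum.inl f → S.lab (m u) = Sum.inl f
  suc : ∀ u ∈ L.nodes, ∀ f : F, L.lab u = Sum.inl f → S.suc (m u) = (L.suc u).map m

/-- `S ≥_m T`: `m` is a morphism whose label and successor conditions hold at
*all* nodes of `S`, including variable nodes. -/
structure IsGeMorph (S T : PreGraph (F ⊕ V)) (m : ℕ → ℕ) : Prop where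
  maps : ∀ u ∈ S.nodes, m u ∈ T.nodes
  root : m S.root = T.root
  lab : ∀ u ∈ S.nodes, T.lab (m u) = S.lab u
  suc : ∀ u ∈ S.nodes, T.suc (m u) = (S.suc u).map m

open Classical in
/-- The substitution `σ_m` induced by a morphism `m : L → S`: a variable `x`
labelling the (unique) node `u` of `L` is mapped to `term(S↾m(u))`. -/
noncomputable def inducedSubst [Inhabited V] (L S : PreGraph (F ⊕ V)) (m : ℕ → ℕ) :
    V → Tm F V := fun x =>
  if h : ∃ u, u ∈ L.nodes ∧ L.lab u = Sum.inr x then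
    termOf (subgraph S (m h.choose))
  else Tm.var x

/-- `S ⊒_{u,v} T` (for nodes `u ≽ v` of `S`, taking `≻` to be the usual order
on `ℕ`): `S ≥_m T` for the morphism `m` with `m u = v` and `m w = w` for all
other nodes `w`. -/
def Collapse (S T : PreGraph (F ⊕ V)) (u v : ℕ) : Prop :=
  u ∈ S.nodes ∧ v ∈ S.nodes ∧ v ≤ u ∧
    IsGeMorph S T (fun w => if w = u then v else w)

/-- `S ⊐_{u,v} T`: `S ⊒_{u,v} T` with `u ≠ v`. -/
def CollapseS (S T : PreGraph (F ⊕ V)) (u v : ℕ) : Prop :=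
  Collapse S T u v ∧ u ≠ v

/-- The single-step folding relation `S ⊐ T`. -/
def Fold (S T : PreGraph (F ⊕ V)) : Prop := ∃ u v, CollapseS S T u v

/-- `S ⊐_p T`: `S` folds strictly below the position `p` to `T`. -/
def FoldBelow (p : List ℕ) (S T : PreGraph (F ⊕ V)) : Prop :=
  ∃ u v, CollapseS S T u v ∧ StrictlyBelow S p u ∧ StrictlyBelow S p v

/-- `S ▷_p T`: `S` unfolds above the position `p` to `T`, i.e. `T ⊐_{u,v} S`
for some node `u` of `T` that is unshared in `T` and whose unique position is
a prefix of `p`. -/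
def UnfoldAbove (p : List ℕ) (S T : PreGraph (F ⊕ V)) : Prop :=
  ∃ u v, CollapseS T S u v ∧ ∃ q, q <+: p ∧ (∀ q', IsPos T u q' ↔ q' = q)

/-- The relation `⊐` restricted to term graphs. -/
def FoldTG (ar : F → ℕ) (S T : PreGraph (F ⊕ V)) : Prop :=
  IsTermGraph ar S ∧ IsTermGraph ar T ∧ Fold S T

/-- The relation `⊐_p` restricted to term graphs. -/
def FoldBelowTG (ar : F → ℕ) (p : List ℕ) (S T : PreGraph (F ⊕ V)) : Prop :=
  IsTermGraph ar S ∧ IsTermGraph ar T ∧ FoldBelow p S T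

/-- The relation `▷_p` restricted to term graphs. -/
def UnfoldAboveTG (ar : F → ℕ) (p : List ℕ) (S T : PreGraph (F ⊕ V)) : Prop :=
  IsTermGraph ar S ∧ IsTermGraph ar T ∧ UnfoldAbove p S T

/-- `a →^! b` for an abstract relation `r`: `a r^* b` and `b` is `r`-minimal. -/
def NormTo {α : Type _} (r : α → α → Prop) (a b : α) : Prop :=
  Relation.ReflTransGen r a b ∧ ∀ c, ¬ r b c

/-- The `n`-fold composition of an abstract relation. -/
def Iter {α : Type _} (r : α → α → Prop) : ℕ → α → α → Prop
  | 0 => Eq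
  | n + 1 => fun a c => ∃ b, r a b ∧ Iter r n b c

/-- The node `u` of `G` is labelled by a variable. -/
def IsVarNode (G : PreGraph (F ⊕ V)) (u : ℕ) : Prop := ∃ x : V, G.lab u = Sum.inr x

/-- A graph rewrite rule `L → R`: `L` and `R` are properly sharing term
graphs, `root(L)` is not a variable node, every variable of `R` occurs in
`L`, and `root(L)` is not a node of `R`. -/
structure IsRule (ar : F → ℕ) (Lhs Rhs : PreGraph (F ⊕ V)) : Prop where
  lhs : IsTermGraph ar Lhs
  rhs : IsTermGraph ar Rhs
  sharing : ProperlySharing Lhs Rhs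
  rootNotVar : ¬ IsVarNode Lhs Lhs.root
  varsSub : ∀ x : V, (∃ u ∈ Rhs.nodes, Rhs.lab u = Sum.inr x) →
      (∃ u ∈ Lhs.nodes, Lhs.lab u = Sum.inr x)
  rootNotInRhs : Lhs.root ∉ Rhs.nodes

/-- `m(R)`: the graph obtained from `R` by replacing every node `v` in the
domain `dom` of the morphism `m` by `m v`; the replaced nodes keep the labels
and successor sequences they have in `S`. -/
def applyMorph (dom : Finset ℕ) (m : ℕ → ℕ) (S R : PreGraph (F ⊕ V)) :
    PreGraph (F ⊕ V) where
  nodes := R.nodes.image fun v => if v ∈ dom then m v else v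
  suc := fun w => if w ∈ S.nodes then S.suc w
                  else (R.suc w).map fun x => if x ∈ dom then m x else x
  lab := fun w => if w ∈ S.nodes then S.lab w else R.lab w
  root := if R.root ∈ dom then m R.root else R.root

/-- `φ` exhibits `G'` as an isomorphic copy of `G`. -/
structure GIsoOn (φ : ℕ → ℕ) (G G' : PreGraph (F ⊕ V)) : Prop where
  nodes : G'.nodes = G.nodes.image φ
  root : φ G.root = G'.root
  lab : ∀ u ∈ G.nodes, G'.lab (φ u) = G.lab u
  suc : ∀ u ∈ G.nodes, G'.suc (φ u) = (G.suc u).map φ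

/-- `L' → R'` is a renaming of the rule `L → R` with respect to `S`: an
isomorphic copy that is node-disjoint from `S`. -/
def IsRenaming (L R L' R' S : PreGraph (F ⊕ V)) : Prop :=
  ∃ φ : ℕ → ℕ, Set.InjOn φ ↑(L.nodes ∪ R.nodes) ∧
    GIsoOn φ L L' ∧ GIsoOn φ R R' ∧ Disjoint (L'.nodes ∪ R'.nodes) S.nodes

/-- `S ⇒_{G,u} T`: a graph rewrite step at the node `u`, using a renaming
`L' → R'` of some rule of `G`, a morphism `m : L' → S↾u`, and
`T = S[u ← m(R')]`. -/
def GStepAt (G : Set (PreGraph (F ⊕ V) × PreGraph (F ⊕ V))) (u : ℕ)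
    (S T : PreGraph (F ⊕ V)) : Prop :=
  ∃ LR ∈ G, ∃ L' R' : PreGraph (F ⊕ V), ∃ m : ℕ → ℕ,
    IsRenaming LR.1 LR.2 L' R' S ∧
    IsMorphism L' (subgraph S u) m ∧
    T = replaceAt S u (applyMorph L'.nodes m S R')

/-- `S ⇒_{G,p} T`: a graph rewrite step at the node corresponding to the
position `p`. -/
def GStepP (G : Set (PreGraph (F ⊕ V) × PreGraph (F ⊕ V))) (p : List ℕ)
    (S T : PreGraph (F ⊕ V)) : Prop :=
  ∃ u, IsPos S u p ∧ GStepAt G u S T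

/-- A term rewrite system: a finite set of rules `l → r` where `l` is not a
variable and every variable of `r` occurs in `l`. -/
def IsTRS (R : Set (Tm F V × Tm F V)) : Prop :=
  R.Finite ∧ ∀ lr ∈ R, (∀ x : V, lr.1 ≠ Tm.var x) ∧
    ∀ x : V, OccursIn x lr.2 → OccursIn x lr.1

/-- `s →_{R,p} t`: a rewrite step of the TRS `R` at position `p`. -/
inductive RewriteAt (R : Set (Tm F V × Tm F V)) : List ℕ → Tm F V → Tm F V → Prop
  | root {l r : Tm F V} (σ : V → Tm F V) :
      (l, r) ∈ R → RewriteAt R [] (substTm σ l) (substTm σ r)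
  | congr {i : ℕ} {p : List ℕ} {f : F} {ts : List (Tm F V)} {t t' : Tm F V} :
      ts[i]? = some t → RewriteAt R p t t' →
      RewriteAt R (i :: p) (Tm.app f ts) (Tm.app f (ts.set i t'))

/-- A graph is minimally sharing if every node is a variable node or unshared. -/
def MinimallySharing (G : PreGraph (F ⊕ V)) : Prop :=
  ∀ u ∈ G.nodes, IsVarNode G u ∨ Unshared G u

/-- A graph is maximally sharing if distinct nodes represent distinct terms. -/
def MaximallySharing [Inhabited V] (G : PreGraph (F ⊕ V)) : Prop :=
  ∀ u ∈ G.nodes, ∀ v ∈ G.nodes,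
    termOf (subgraph G u) = termOf (subgraph G v) → u = v

/-- `G ∈ Tree(s)`: `G` is a minimally sharing term graph representing `s`. -/
def InTree [Inhabited V] (ar : F → ℕ) (s : Tm F V) (G : PreGraph (F ⊕ V)) : Prop :=
  IsTermGraph ar G ∧ MinimallySharing G ∧ termOf G = s

/-- `G ∈ Shared(s)`: `G` is a maximally sharing term graph representing `s`. -/
def InShared [Inhabited V] (ar : F → ℕ) (s : Tm F V) (G : PreGraph (F ⊕ V)) : Prop :=
  IsTermGraph ar G ∧ MaximallySharing G ∧ termOf G = s

/-- `L → R` is a graph rewrite rule simulating the term rewrite rule `l → r`: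
`L ∈ Tree(l)`, `R ∈ Tree(r)` and the common nodes of `L` and `R` are exactly
the variable nodes of `R`. -/
def SimRule [Inhabited V] (ar : F → ℕ) (l r : Tm F V)
    (Lg Rg : PreGraph (F ⊕ V)) : Prop :=
  IsRule ar Lg Rg ∧ InTree ar l Lg ∧ InTree ar r Rg ∧
    ∀ w : ℕ, (w ∈ Lg.nodes ∧ w ∈ Rg.nodes) ↔ (w ∈ Rg.nodes ∧ IsVarNode Rg w)

/-- `G` is the simulating graph rewrite system `G(R)` of the TRS `R`. -/
def IsSimGRS [Inhabited V] (ar : F → ℕ) (R : Set (Tm F V × Tm F V))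
    (G : Set (PreGraph (F ⊕ V) × PreGraph (F ⊕ V))) : Prop :=
  (∀ lr ∈ R, ∃ LR ∈ G, SimRule ar lr.1 lr.2 LR.1 LR.2) ∧
  (∀ LR ∈ G, ∃ lr ∈ R, SimRule ar lr.1 lr.2 LR.1 LR.2)

/-- `S ⇒ˢ_{G,p} T`: `S ▷_p^! U`, `U ⊐_p^! V` and `V ⇒_{G,p} T` for some
term graphs `U`, `V`. -/
def SStepP (ar : F → ℕ) (G : Set (PreGraph (F ⊕ V) × PreGraph (F ⊕ V)))
    (p : List ℕ) (S T : PreGraph (F ⊕ V)) : Prop :=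
  ∃ U Vg : PreGraph (F ⊕ V),
    NormTo (UnfoldAboveTG ar p) S U ∧ NormTo (FoldBelowTG ar p) U Vg ∧
    GStepP G p Vg T

/-- `S ⇒ˢ_G T`: an `⇒ˢ`-step at some position. -/
def SStep (ar : F → ℕ) (G : Set (PreGraph (F ⊕ V) × PreGraph (F ⊕ V)))
    (S T : PreGraph (F ⊕ V)) : Prop :=
  ∃ p : List ℕ, SStepP ar G p S T

/-- `G` has a path of `n` edges. -/
def HasPathLen (G : PreGraph L) (n : ℕ) : Prop :=
  ∃ l : List ℕ, l.length = n + 1 ∧ l.Chain' (Edge G) ∧ ∀ x ∈ l, x ∈ G.nodes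

/-- The depth of `G`: the length of the longest path in `G`. -/
noncomputable def depth (G : PreGraph L) : ℕ := sSup {n | HasPathLen G n}

/-- Filling every hole of a context (a term over `F ∪ {□}`, the hole `□`
being represented by `none`) with the term `t`. -/
def fillAll (t : Tm F V) : Tm (Option F) V → Tm F V
  | Tm.var x => Tm.var x
  | Tm.app none _ => t
  | Tm.app (some f) ts => Tm.app f (ts.attach.map fun c => fillAll t c.1)
decreasing_by
  have := List.sizeOf_lt_of_mem c.2
  simp only [Tm.app.sizeOf_spec]
  omega

/-- Viewing a graph over `F ∪ V` as a graph over `(F ∪ {□}) ∪ V`. -/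
def relabel (G : PreGraph (F ⊕ V)) : PreGraph (Option F ⊕ V) where
  nodes := G.nodes
  suc := G.suc
  lab := fun u => Sum.map some id (G.lab u)
  root := G.root

/-- The one-node graph consisting of a hole node `h` labelled `□`. -/
def holeGraph (h : ℕ) : PreGraph (Option F ⊕ V) where
  nodes := {h}
  suc := fun _ => []
  lab := fun _ => Sum.inl none
  root := h

theorem fillAll_app_some (t : Tm F V) (f : F) (ts : List (Tm (Option F) V)) :
    fillAll t (Tm.app (some f) ts) = Tm.app f (ts.map (fillAll t)) := by
  rw [fillAll]
  simp

/-- The node set of `G` is closed under successors. -/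
def SucClosed (G : PreGraph L) : Prop := ∀ v ∈ G.nodes, ∀ w ∈ G.suc v, w ∈ G.nodes

/-- The function `r` strictly decreases along the edges of `G`. -/
def IsRank (G : PreGraph L) (r : ℕ → ℕ) : Prop := ∀ v ∈ G.nodes, ∀ w ∈ G.suc v, r w < r v

theorem IsRank.lt_of_transGen {G : PreGraph L} {r : ℕ → ℕ} (hr : IsRank G r) {v w : ℕ}
    (h : Relation.TransGen (Edge G) v w) : r w < r v := by
  induction h with
  | single e => exact hr _ e.1 _ e.2
  | tail _ e ih => exact (hr _ e.1 _ e.2).trans ih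

open Classical in
/-- A finite acyclic graph has a rank function bounded by its number of nodes. -/
theorem exists_isRank_lt_card {G : PreGraph L} (hc : SucClosed G)
    (ha : ∀ v w : ℕ, Relation.TransGen (Edge G) v w → v ≠ w) :
    ∃ r, IsRank G r ∧ ∀ v ∈ G.nodes, r v < G.nodes.card := by
  refine ⟨fun v => (G.nodes.filter fun w => Relation.TransGen (Edge G) v w).card, ?_, ?_⟩
  · intro v hv w hw
    refine Finset.card_lt_card ((Finset.ssubset_iff_of_subset ?_).2 ⟨w, ?_, ?_⟩)
    · intro x hx
      rw [Finset.mem_filter] at hx ⊢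
      exact ⟨hx.1, Relation.TransGen.head ⟨hv, hw⟩ hx.2⟩
    · exact Finset.mem_filter.2 ⟨hc v hv w hw, Relation.TransGen.single ⟨hv, hw⟩⟩
    · exact fun hx => ha w w (Finset.mem_filter.1 hx).2 rfl
  · intro v hv
    refine Finset.card_lt_card ((Finset.ssubset_iff_of_subset (Finset.filter_subset _ _)).2
      ⟨v, hv, fun hx => ha v v (Finset.mem_filter.1 hx).2 rfl⟩)

/-- Fuel exceeding the rank of a node does not influence the computed term. -/
theorem termAt_eq_of_rank_lt [Inhabited V] {G : PreGraph (F ⊕ V)} {r : ℕ → ℕ}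
    (hc : SucClosed G) (hr : IsRank G r) (n : ℕ) :
    ∀ m, ∀ v ∈ G.nodes, r v < n → r v < m → termAt G n v = termAt G m v := by
  induction n with
  | zero => intro m v _ h; omega
  | succ n ih =>
    intro m v hv hn hm
    obtain _ | m := m
    · omega
    · simp only [termAt]
      cases G.lab v with
      | inr x => rfl
      | inl f =>
        refine congrArg (Tm.app f) (List.map_congr_left fun w hw => ?_)
        have := hr v hv w hw
        exact ih m w (hc v hv w hw) (by omega) (by omega)

theorem termOf_eq_termAt [Inhabited V] {G : PreGraph (F ⊕ V)} {r : ℕ → ℕ}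
    (hc : SucClosed G) (hr : IsRank G r) (hroot : G.root ∈ G.nodes) {n : ℕ}
    (hn : G.nodes.card ≤ n) : termOf G = termAt G n G.root := by
  obtain ⟨s, hs, hlt⟩ := exists_isRank_lt_card hc
    fun v w h e => (hr.lt_of_transGen h).ne (congrArg r e.symm)
  have := hlt _ hroot
  exact termAt_eq_of_rank_lt hc hs _ _ _ hroot (by omega) (by omega)

theorem termAt_subgraph [Inhabited V] (G : PreGraph (F ⊕ V)) (v n : ℕ) :
    ∀ w, termAt (subgraph G v) n w = termAt G n w := by
  induction n with
  | zero => intro w; rfl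
  | succ n ih => intro w; simp only [termAt, ih]; rfl

theorem SucClosed.subgraph {G : PreGraph L} (hc : SucClosed G) (u : ℕ) :
    SucClosed (subgraph G u) := by
  intro v hv w hw
  simp only [TermGraphs.subgraph, Finset.mem_filter] at hv hw ⊢
  exact ⟨hc v hv.1 w hw, hv.2.tail ⟨hv.1, hw⟩⟩

theorem IsRank.subgraph {G : PreGraph L} {r : ℕ → ℕ} (hr : IsRank G r) (u : ℕ) :
    IsRank (subgraph G u) r := by
  classical
  exact fun v hv w hw => hr v (Finset.mem_filter.1 hv).1 w hw

theorem termOf_subgraph_eq_termAt [Inhabited V] {G : PreGraph (F ⊕ V)} {r : ℕ → ℕ}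
    (hc : SucClosed G) (hr : IsRank G r) {v : ℕ} (hv : v ∈ G.nodes) {n : ℕ}
    (hn : G.nodes.card ≤ n) : termOf (subgraph G v) = termAt G n v := by
  classical
  rw [termOf_eq_termAt (n := n) (hc.subgraph v) (hr.subgraph v)
    (Finset.mem_filter.2 ⟨hv, Relation.ReflTransGen.refl⟩)
    ((Finset.card_filter_le _ _).trans hn), termAt_subgraph]
  rfl

section Replacement

variable {G H : PreGraph L} {u : ℕ}

theorem mem_nodes_gUnion_redirect {w : ℕ} :
    w ∈ (gUnion H (redirect G u H.root)).nodes ↔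
      w ∈ H.nodes ∨ w = H.root ∨ (w ≠ u ∧ w ∈ G.nodes) := by
  simp [gUnion, redirect, or_left_comm]

theorem sucClosed_gUnion_redirect (hG : SucClosed G) (hH : SucClosed H)
    (hroot : H.root ∈ H.nodes) : SucClosed (gUnion H (redirect G u H.root)) := by
  intro v hv w hw
  rw [mem_nodes_gUnion_redirect] at hv ⊢
  by_cases hvH : v ∈ H.nodes
  · simp only [gUnion, hvH, if_true] at hw
    exact Or.inl (hH v hvH w hw)
  · simp only [gUnion, hvH, if_false, redirect, List.mem_map] at hw
    obtain ⟨x, hx, rfl⟩ := hw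
    have hvG : v ∈ G.nodes := by
      rcases hv with hv | rfl | hv
      exacts [absurd hv hvH, absurd hroot hvH, hv.2]
    split_ifs with hxu
    · exact Or.inl hroot
    · exact Or.inr (Or.inr ⟨hxu, hG v hvG x hx⟩)

theorem exists_isRank_gUnion_redirect {r s : ℕ → ℕ} (hG : IsRank G r) (hH : IsRank H s)
    (hcH : SucClosed H) (hroot : H.root ∈ H.nodes) :
    ∃ q, IsRank (gUnion H (redirect G u H.root)) q := by
  refine ⟨fun w => if w ∈ H.nodes then s w else H.nodes.sup s + 1 + r w, fun v hv w hw => ?_⟩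
  rw [mem_nodes_gUnion_redirect] at hv
  by_cases hvH : v ∈ H.nodes
  · simp only [gUnion, hvH, if_true] at hw
    simpa [hvH, hcH v hvH w hw] using hH v hvH w hw
  · simp only [gUnion, hvH, if_false, redirect, List.mem_map] at hw
    obtain ⟨x, hx, rfl⟩ := hw
    have hvG : v ∈ G.nodes := by
      rcases hv with hv | rfl | hv
      exacts [absurd hv hvH, absurd hroot hvH, hv.2]
    have hlt := hG v hvG x hx
    have hsup : ∀ y ∈ H.nodes, s y ≤ H.nodes.sup s := fun y hy => Finset.le_sup hy
    simp only [hvH, if_false]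
    by_cases hxu : x = u
    · have := hsup _ hroot
      simp only [hxu, if_true, hroot]
      omega
    · simp only [hxu, if_false]
      split_ifs with hx'
      · have := hsup _ hx'
        omega
      · omega

end Replacement

/-- On the nodes of `T`, the union `T ∪ G` represents the same terms as `T`. -/
theorem termAt_gUnion_left [Inhabited V] {T : PreGraph (F ⊕ V)} (hT : SucClosed T)
    (G : PreGraph (F ⊕ V)) (n : ℕ) :
    ∀ w ∈ T.nodes, termAt (gUnion T G) n w = termAt T n w := by
  induction n with
  | zero => intro w _; rfl
  | succ n ih =>
    intro w hw
    simp only [termAt, gUnion, hw, if_true]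
    cases T.lab w with
    | inr x => rfl
    | inl f =>
      exact congrArg (Tm.app f) (List.map_congr_left fun v hv => ih v (hT w hw v hv))

section Context

variable {S T : PreGraph (F ⊕ V)} {u h : ℕ}

theorem lab_gUnion_holeGraph {w : ℕ} (hwh : w ≠ h) :
    (gUnion (holeGraph h) (redirect (relabel S) u h)).lab w = Sum.map some id (S.lab w) := by
  simp [gUnion, redirect, relabel, holeGraph, hwh]

theorem suc_gUnion_holeGraph {w : ℕ} (hwh : w ≠ h) :
    (gUnion (holeGraph h) (redirect (relabel S) u h)).suc w =
      (S.suc w).map fun x => if x = u then h else x := by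
  simp [gUnion, redirect, relabel, holeGraph, hwh]

variable [Inhabited V]

/-- Below the nodes shared with `T`, the context contains no hole. -/
theorem fillAll_termAt_of_mem (hS : SucClosed S) (hT : SucClosed T)
    (hps : ProperlySharing S T) (huT : u ∉ T.nodes) (hh : h ∉ S.nodes) (t : Tm F V) (n : ℕ) :
    ∀ w ∈ S.nodes, w ∈ T.nodes →
      fillAll t (termAt (gUnion (holeGraph h) (redirect (relabel S) u h)) n w) =
        termAt T n w := by
  induction n with
  | zero => intro w _ _; simp [termAt, fillAll]
  | succ n ih =>
    intro w hwS hwT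
    have hwh : w ≠ h := fun e => hh (e ▸ hwS)
    obtain ⟨hlab, hsuc⟩ := hps w hwS hwT
    simp only [termAt, lab_gUnion_holeGraph hwh, suc_gUnion_holeGraph hwh, ← hlab, ← hsuc]
    cases S.lab w with
    | inr x => simp [fillAll]
    | inl f =>
      simp only [Sum.map_inl, fillAll_app_some, List.map_map]
      refine congrArg (Tm.app f) (List.map_congr_left fun v hv => ?_)
      have hvT : v ∈ T.nodes := hT w hwT v (hsuc ▸ hv)
      have hvu : v ≠ u := fun e => huT (e ▸ hvT)
      simpa [hvu] using ih v (hS w hwS v hv) hvT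

theorem fillAll_termAt_hole (S : PreGraph (F ⊕ V)) (t : Tm F V) {n : ℕ} (hn : 0 < n) :
    fillAll t (termAt (gUnion (holeGraph h) (redirect (relabel S) u h)) n h) = t := by
  obtain ⟨n, rfl⟩ := Nat.exists_eq_succ_of_ne_zero hn.ne'
  simp [termAt, gUnion, holeGraph, fillAll]

theorem termAt_replacement {r : ℕ → ℕ} (hS : SucClosed S) (hr : IsRank S r) (hT : SucClosed T)
    (hroot : T.root ∈ T.nodes) (hps : ProperlySharing S T) (huT : u ∉ T.nodes)
    (hh : h ∉ S.nodes) {t : Tm F V} {k : ℕ} (ht : ∀ n, k ≤ n → termAt T n T.root = t) (n : ℕ) :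
    ∀ w ∈ S.nodes, w ≠ u → k + r w < n →
      termAt (gUnion T (redirect S u T.root)) n w =
        fillAll t (termAt (gUnion (holeGraph h) (redirect (relabel S) u h)) n w) := by
  induction n with
  | zero => intro w _ _ hn; omega
  | succ n ih =>
    intro w hwS hwu hn
    by_cases hwT : w ∈ T.nodes
    · rw [fillAll_termAt_of_mem hS hT hps huT hh t _ w hwS hwT, termAt_gUnion_left hT _ _ w hwT]
    · have hwh : w ≠ h := fun e => hh (e ▸ hwS)
      have hA : (gUnion T (redirect S u T.root)).lab w = S.lab w := by
        simp [gUnion, redirect, hwT]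
      have hA' : (gUnion T (redirect S u T.root)).suc w =
          (S.suc w).map fun x => if x = u then T.root else x := by
        simp [gUnion, redirect, hwT]
      simp only [termAt, hA, hA', lab_gUnion_holeGraph hwh, suc_gUnion_holeGraph hwh]
      cases S.lab w with
      | inr x => simp [fillAll]
      | inl f =>
        simp only [Sum.map_inl, fillAll_app_some, List.map_map]
        refine congrArg (Tm.app f) (List.map_congr_left fun v hv => ?_)
        have hlt := hr w hwS v hv
        by_cases hvu : v = u
        · simp only [Function.comp_apply, hvu, if_true]
          rw [fillAll_termAt_hole S t (by omega), termAt_gUnion_left hT _ _ _ hroot,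
            ht n (by omega)]
        · simpa [hvu] using ih v (hS w hwS v hv) hvu (by omega)

end Context

/-- For properly sharing term graphs `S`, `T`, a node `u` of `S`
not in `T`, and `C = term(S[u ← □])` (with `□` a fresh hole constant,
represented by the one-node graph `holeGraph h` for a fresh node `h`),
`term(S[u ← T])` is obtained from `C` by filling every hole with `term(T)`. -/
theorem term_of_replacement_is_context_filled {F V : Type} [Inhabited V] (ar : F → ℕ)
    (S T : PreGraph (F ⊕ V)) (hS : IsTermGraph ar S) (hT : IsTermGraph ar T)
    (hps : ProperlySharing S T) (u : ℕ) (hu : u ∈ S.nodes) (huT : u ∉ T.nodes)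
    (h : ℕ) (hh : h ∉ S.nodes) :
    termOf (replaceAt S u T) =
      fillAll (termOf T)
        (termOf (replaceAt (relabel S) u (holeGraph (F := F) (V := V) h))) := by
  obtain ⟨r, hr, -⟩ := exists_isRank_lt_card hS.closed hS.acyclic
  obtain ⟨s, hs, -⟩ := exists_isRank_lt_card hT.closed hT.acyclic
  have hcS : SucClosed S := hS.closed
  have hcT : SucClosed T := hT.closed
  have hcH : SucClosed (holeGraph (F := F) (V := V) h) := fun _ _ _ hw =>
    absurd hw (by simp [holeGraph])
  have hrH : IsRank (holeGraph (F := F) (V := V) h) r := fun _ _ _ hw =>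
    absurd hw (by simp [holeGraph])
  have hh_root : (holeGraph (F := F) (V := V) h).root ∈ (holeGraph (F := F) (V := V) h).nodes :=
    Finset.mem_singleton_self h
  obtain ⟨a, ha⟩ := exists_isRank_gUnion_redirect (u := u) hr hs hcT hT.rootMem
  obtain ⟨b, hb⟩ := exists_isRank_gUnion_redirect (u := u) (G := relabel S) hr hrH hcH hh_root
  have hcA := sucClosed_gUnion_redirect (u := u) hcS hcT hT.rootMem
  have hcB := sucClosed_gUnion_redirect (u := u) (G := relabel S) hcS hcH hh_root
  have ht : ∀ n, T.nodes.card ≤ n → termAt T n T.root = termOf T := fun n hn =>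
    (termOf_eq_termAt hcT hs hT.rootMem hn).symm
  set n := (gUnion T (redirect S u T.root)).nodes.card +
    (gUnion (holeGraph (F := F) (V := V) h) (redirect (relabel S) u h)).nodes.card +
    T.nodes.card + r S.root + 1 with hn
  have hrS : (relabel S).root = S.root := rfl
  unfold replaceAt
  rw [hrS]
  by_cases hroot : u = S.root
  · rw [if_pos hroot, if_pos hroot,
      termOf_subgraph_eq_termAt (n := n) hcA ha
        (mem_nodes_gUnion_redirect.2 (Or.inl hT.rootMem)) (by omega),
      termOf_subgraph_eq_termAt (n := n) hcB hb
        (mem_nodes_gUnion_redirect.2 (Or.inl hh_root)) (by simp only [holeGraph] at *; omega),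
      termAt_gUnion_left hcT _ _ _ hT.rootMem, ht n (by omega)]
    exact (fillAll_termAt_hole S (termOf T) (by omega)).symm
  · rw [if_neg hroot, if_neg hroot,
      termOf_subgraph_eq_termAt (n := n) hcA ha
        (mem_nodes_gUnion_redirect.2 (Or.inr (Or.inr ⟨Ne.symm hroot, hS.rootMem⟩))) (by omega),
      termOf_subgraph_eq_termAt (n := n) hcB hb
        (mem_nodes_gUnion_redirect.2 (Or.inr (Or.inr ⟨Ne.symm hroot, hS.rootMem⟩)))
        (by simp only [holeGraph] at *; omega)]
    exact termAt_replacement hcS hr hcT hT.rootMem hps huT hh ht n S.root hS.rootMem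
      (Ne.symm hroot) (by omega)

end TermGraphs
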